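/- Let G ∈ W₊^{m×p} (Wiener class) with T_G T_G* strictly positive. Then for every ζ on the unit circle 𝕋, (Θ₀*Θ₀)⁻¹ Θ₀* (I_p − Ξ₀ G₀) Y(ζ)⁻¹ = θ(ζ)* (I_p − Ξ(ζ) G(ζ)), where Ξ(z) = Y(z)Ξ₀, θ(z) = Y(z)Θ₀ and G₀ = G(0); that is, the function H of item (iii) of the main theorem coincides on 𝕋 with the Tolokonnikov-type function ζ ↦ θ(ζ)*(I_p − Ξ(ζ)G(ζ)). -/

import Mathlib

/-!
Setting: `l2 n` models ℓ²₊(ℂⁿ); `lp.single 2 0` is the canonical embedding `E_n`, and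
evaluating a sequence at coordinate `k` realizes `E_n* (S_n*)^k`.  Block Toeplitz and
Hankel operators, as well as the (bounded) inverse of `T_G T_G*`, are specified through
their actions on the standard basis vectors of the coordinate spaces.
-/

noncomputable section
open scoped Matrix

/-- ℂⁿ with the Euclidean norm. -/
abbrev ES (n : ℕ) : Type := EuclideanSpace ℂ (Fin n)

/-- ℓ²₊(ℂⁿ). -/
abbrev l2 (n : ℕ) : Type := lp (fun _ : ℕ => ES n) 2

/-- The `b`-th standard basis vector of ℂⁿ. -/
abbrev eVec (n : ℕ) (b : Fin n) : ES n := EuclideanSpace.single b 1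

/-- The matrix function `z ↦ ∑' ν, z ^ ν • F ν` determined by a coefficient sequence. -/
def seriesM {r s : ℕ} (F : ℕ → Matrix (Fin r) (Fin s) ℂ) (z : ℂ) :
    Matrix (Fin r) (Fin s) ℂ :=
  Matrix.of fun a b => ∑' ν : ℕ, z ^ ν * F ν a b

open scoped InnerProductSpace

/-- Expansion of a linear map out of `ES n` applied to a vector along the standard basis. -/
theorem ES.eq_sum_smul_eVec {n : ℕ} (v : ES n) : v = ∑ b, v b • eVec n b := by
  ext a
  simp [Finset.sum_apply, Pi.single_apply]

theorem lp.single_eq_sum_smul_eVec {n : ℕ} (j : ℕ) (v : ES n) :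
    (lp.single 2 j v : l2 n) = ∑ b, v b • (lp.single 2 j (eVec n b) : l2 n) := by
  have h := congrArg (lp.singleContinuousLinearMap ℂ (fun _ : ℕ => ES n) 2 j)
    (ES.eq_sum_smul_eVec v)
  rw [map_sum] at h
  simpa only [map_smul, lp.singleContinuousLinearMap_apply] using h

/-- The `(i, a)` coordinate functional on `l2 n`. -/
def l2Coord (n i : ℕ) (a : Fin n) : l2 n →L[ℂ] ℂ :=
  (EuclideanSpace.proj a).comp (lp.evalCLM (𝕜 := ℂ) (fun _ : ℕ => ES n) (p := 2) i)

@[simp] theorem l2Coord_apply {n i : ℕ} {a : Fin n} (x : l2 n) : l2Coord n i a x = x i a := rfl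

theorem apply_single_coord {n r : ℕ} (A : l2 n →L[ℂ] l2 r) (j : ℕ) (v : ES n) (i : ℕ)
    (a : Fin r) :
    (A (lp.single 2 j v)) i a = ∑ b, (A (lp.single 2 j (eVec n b))) i a * v b := by
  rw [← l2Coord_apply, lp.single_eq_sum_smul_eVec, map_sum, map_sum]
  simp [mul_comm]

/-- The coordinate formula for a block Toeplitz operator. -/
theorem toeplitz_apply {m p : ℕ} {G : ℕ → Matrix (Fin m) (Fin p) ℂ} {T : l2 p →L[ℂ] l2 m}
    (hT : ∀ (j : ℕ) (b : Fin p) (i : ℕ) (a : Fin m),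
      (T (lp.single 2 j (eVec p b))) i a = if j ≤ i then G (i - j) a b else 0)
    (x : l2 p) (i : ℕ) (a : Fin m) :
    (T x) i a = ∑ j ∈ Finset.range (i + 1), ∑ b, G (i - j) a b * x j b := by
  have h := (lp.hasSum_single (p := 2) (by simp) x).mapL ((l2Coord m i a).comp T)
  have h2 := h.tsum_eq
  simp only [ContinuousLinearMap.comp_apply, l2Coord_apply] at h2
  rw [← h2, tsum_eq_sum (s := Finset.range (i + 1))]
  · refine Finset.sum_congr rfl fun j hj => ?_
    rw [apply_single_coord]
    simp [hT, Nat.lt_succ_iff.mp (Finset.mem_range.mp hj)]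
  · intro j hj
    have hj' : ¬ j ≤ i := fun h => hj (Finset.mem_range.mpr (Nat.lt_succ_of_le h))
    rw [apply_single_coord]
    simp [hT, hj']

/-- The forward shift on `l2 n`. -/
def shift {n : ℕ} (x : l2 n) : l2 n :=
  ⟨fun i => Nat.casesOn i 0 fun j => x j, by
    refine memℓp_gen ?_
    refine (summable_nat_add_iff 1).mp ?_
    exact (lp.memℓp x).summable (by simp)⟩

@[simp] theorem shift_zero {n : ℕ} (x : l2 n) : shift x 0 = 0 := rfl

@[simp] theorem shift_succ {n : ℕ} (x : l2 n) (i : ℕ) : shift x (i + 1) = x i := rfl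

theorem shift_injective {n : ℕ} : Function.Injective (shift (n := n)) := fun x y h => by
  ext1
  funext i
  rw [← shift_succ x, h, shift_succ]

theorem shift_zero_vec {n : ℕ} : shift (0 : l2 n) = 0 := by
  ext1
  funext i
  cases i <;> rfl

/-- The backward shift of a sequence in `l2 n` is again in `l2 n`. -/
theorem exists_tail {n : ℕ} (x : l2 n) : ∃ h : l2 n, ∀ i, h i = x (i + 1) :=
  ⟨⟨fun i => x (i + 1), memℓp_gen
    ((summable_nat_add_iff 1).mpr ((lp.memℓp x).summable (by simp)))⟩, fun _ => rfl⟩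

theorem exists_eq_shift {n : ℕ} {x : l2 n} (hx : x 0 = 0) : ∃ h, x = shift h := by
  obtain ⟨h, hh⟩ := exists_tail x
  refine ⟨h, ?_⟩
  ext1
  funext i
  cases i with
  | zero => exact hx
  | succ i => exact (hh i).symm

theorem inner_shift_right {n : ℕ} (x y : l2 n) :
    ⟪x, shift y⟫_ℂ = ∑' i, ⟪x (i + 1), y i⟫_ℂ := by
  have h : Summable fun i : ℕ => ⟪x i, shift y i⟫_ℂ := lp.summable_inner x (shift y)
  rw [lp.inner_eq_tsum, h.tsum_eq_zero_add, shift_zero, inner_zero_right, zero_add]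
  rfl

theorem inner_shift_shift {n : ℕ} (x y : l2 n) : ⟪shift x, shift y⟫_ℂ = ⟪x, y⟫_ℂ := by
  rw [inner_shift_right, lp.inner_eq_tsum]
  rfl

theorem inner_iterate_shift {n : ℕ} (x y : l2 n) (k : ℕ) :
    ⟪x, shift^[k] y⟫_ℂ = ∑' i, ⟪x (i + k), y i⟫_ℂ := by
  induction k generalizing x with
  | zero => exact lp.inner_eq_tsum x y
  | succ k ih =>
    obtain ⟨h, hh⟩ := exists_tail x
    have e : ⟪x, shift^[k + 1] y⟫_ℂ = ⟪h, shift^[k] y⟫_ℂ := by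
      rw [Function.iterate_succ_apply', inner_shift_right, lp.inner_eq_tsum]
      exact tsum_congr fun i => by rw [hh]
    rw [e, ih]
    exact tsum_congr fun i => by rw [hh, add_assoc]

/-- An analytic Toeplitz operator commutes with the shift. -/
theorem toeplitz_shift {m p : ℕ} {G : ℕ → Matrix (Fin m) (Fin p) ℂ} {T : l2 p →L[ℂ] l2 m}
    (hT : ∀ x i a, (T x) i a = ∑ j ∈ Finset.range (i + 1), ∑ b, G (i - j) a b * x j b)
    (x : l2 p) : T (shift x) = shift (T x) := by
  ext i a
  rw [hT]
  cases i with
  | zero => simp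
  | succ i =>
    rw [shift_succ, hT, Finset.sum_range_succ']
    simp

theorem toeplitz_zero {m p : ℕ} {G : ℕ → Matrix (Fin m) (Fin p) ℂ} {T : l2 p →L[ℂ] l2 m}
    (hT : ∀ x i a, (T x) i a = ∑ j ∈ Finset.range (i + 1), ∑ b, G (i - j) a b * x j b)
    (x : l2 p) : (T x) 0 = WithLp.toLp 2 ((G 0).mulVec (x 0)) := by
  ext a
  rw [hT]
  simp [Matrix.mulVec, dotProduct]

theorem toeplitz_ker_of_shift {m p : ℕ} {G : ℕ → Matrix (Fin m) (Fin p) ℂ}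
    {T : l2 p →L[ℂ] l2 m}
    (hT : ∀ x i a, (T x) i a = ∑ j ∈ Finset.range (i + 1), ∑ b, G (i - j) a b * x j b)
    {x : l2 p} (hx : T (shift x) = 0) : T x = 0 :=
  shift_injective (by rw [← toeplitz_shift hT, hx, shift_zero_vec])

theorem toeplitz_iterate_shift {m p : ℕ} {G : ℕ → Matrix (Fin m) (Fin p) ℂ}
    {T : l2 p →L[ℂ] l2 m}
    (hT : ∀ x i a, (T x) i a = ∑ j ∈ Finset.range (i + 1), ∑ b, G (i - j) a b * x j b)
    {x : l2 p} (hx : T x = 0) (k : ℕ) : T (shift^[k] x) = 0 := by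
  induction k with
  | zero => exact hx
  | succ k ih => rw [Function.iterate_succ_apply', toeplitz_shift hT, ih, shift_zero_vec]

/-- A vector orthogonal to `shift h` for all `h` in the kernel of a Toeplitz operator has, against
kernel vectors, the same inner product with vectors sharing the zeroth coordinate. -/
theorem inner_eq_of_coord_zero_eq {m p : ℕ} {G : ℕ → Matrix (Fin m) (Fin p) ℂ}
    {T : l2 p →L[ℂ] l2 m}
    (hT : ∀ x i a, (T x) i a = ∑ j ∈ Finset.range (i + 1), ∑ b, G (i - j) a b * x j b)
    {f x y : l2 p} (hf : ∀ h, T h = 0 → ⟪f, shift h⟫_ℂ = 0) (hx : T x = 0) (hy : T y = 0)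
    (hxy : x 0 = y 0) : ⟪f, x⟫_ℂ = ⟪f, y⟫_ℂ := by
  obtain ⟨h, hh⟩ := exists_eq_shift (x := x - y) (by simp [hxy])
  have hz := hf h (toeplitz_ker_of_shift hT (by rw [← hh, map_sub, hx, hy, sub_zero]))
  rwa [← hh, inner_sub_right, sub_eq_zero] at hz

/-- A double series over `ℕ × ℕ` whose off-diagonals all sum to zero equals its diagonal sum. -/
theorem tsum_prod_eq_tsum_diag {F : ℕ × ℕ → ℂ} (hF : Summable F)
    (h1 : ∀ k, ∑' i, F (i + (k + 1), i) = 0) (h2 : ∀ k, ∑' i, F (i, i + (k + 1)) = 0) :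
    ∑' q, F q = ∑' i, F (i, i) := by
  have key (n : ℤ) (g : ℕ → ℕ × ℕ) (hg : Function.Injective g)
      (hr : ∀ q : ℕ × ℕ, (q.2 : ℤ) - q.1 = n ↔ q ∈ Set.range g) :
      ∑' q : (fun q : ℕ × ℕ => (q.2 : ℤ) - q.1) ⁻¹' {n}, F q = ∑' i, F (g i) := by
    have hs : (fun q : ℕ × ℕ => (q.2 : ℤ) - q.1) ⁻¹' {n} = Set.range g := by
      ext q
      exact hr q
    rw [hs]
    exact tsum_range F hg
  have h := (hF.hasSum.tsum_fiberwise fun q : ℕ × ℕ => (q.2 : ℤ) - q.1).tsum_eq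
  rw [← h, tsum_eq_single 0]
  · refine key 0 (fun i => (i, i)) (fun i j h => (Prod.ext_iff.mp h).1) fun q => ?_
    constructor
    · exact fun h => ⟨q.1, Prod.ext rfl (by simp only; omega)⟩
    · rintro ⟨i, rfl⟩
      simp
  · intro n hn
    obtain ⟨k, rfl | rfl⟩ := Int.eq_nat_or_neg n
    all_goals
      obtain ⟨k, rfl⟩ := Nat.exists_eq_succ_of_ne_zero (n := k) (by rintro rfl; simp at hn)
    · rw [← h2 k]
      refine key _ (fun i => (i, i + (k + 1))) (fun i j h => (Prod.ext_iff.mp h).1) fun q => ?_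
      constructor
      · exact fun h => ⟨q.1, Prod.ext rfl (by simp only; omega)⟩
      · rintro ⟨i, rfl⟩
        simp
    · rw [← h1 k]
      refine key _ (fun i => (i + (k + 1), i)) (fun i j h => (Prod.ext_iff.mp h).2) fun q => ?_
      constructor
      · exact fun h => ⟨q.2, Prod.ext (by simp only; omega) rfl⟩
      · rintro ⟨i, rfl⟩
        simp only; push_cast; ring

/-- On the unit circle, the inner product of two absolutely summable power series whose nonzero
correlations vanish is the sum of the coefficientwise inner products. -/
theorem inner_tsum_smul {p : ℕ} {x y : ℕ → ES p} (hx : Summable fun i => ‖x i‖)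
    (hy : Summable fun i => ‖y i‖) {ζ : ℂ} (hζ : ‖ζ‖ = 1)
    (h1 : ∀ k, ∑' i, ⟪x (i + (k + 1)), y i⟫_ℂ = 0)
    (h2 : ∀ k, ∑' i, ⟪x i, y (i + (k + 1))⟫_ℂ = 0) :
    ⟪∑' i, ζ ^ i • x i, ∑' j, ζ ^ j • y j⟫_ℂ = ∑' i, ⟪x i, y i⟫_ℂ := by
  have hx' : Summable fun i => ζ ^ i • x i := .of_norm (by simpa [norm_smul, hζ] using hx)
  have hy' : Summable fun i => ζ ^ i • y i := .of_norm (by simpa [norm_smul, hζ] using hy)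
  have hF : Summable fun q : ℕ × ℕ => ⟪ζ ^ q.1 • x q.1, ζ ^ q.2 • y q.2⟫_ℂ := by
    refine .of_norm_bounded
      (hx.mul_of_nonneg hy (fun _ => norm_nonneg _) fun _ => norm_nonneg _) fun q => ?_
    refine (norm_inner_le_norm _ _).trans_eq ?_
    simp [norm_smul, hζ]
  have hcc (n : ℕ) : (starRingEnd ℂ) ζ ^ n * ζ ^ n = 1 := by
    rw [← mul_pow, mul_comm, Complex.mul_conj, Complex.normSq_eq_norm_sq, hζ]
    simp
  have e (i j : ℕ) : ⟪ζ ^ i • x i, ζ ^ j • y j⟫_ℂ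
      = (starRingEnd ℂ) ζ ^ i * ζ ^ j * ⟪x i, y j⟫_ℂ := by
    rw [inner_smul_left, inner_smul_right, map_pow]
    ring
  have hprod : ⟪∑' i, ζ ^ i • x i, ∑' j, ζ ^ j • y j⟫_ℂ
      = ∑' q : ℕ × ℕ, ⟪ζ ^ q.1 • x q.1, ζ ^ q.2 • y q.2⟫_ℂ := by
    rw [hF.tsum_prod, ← innerSLFlip_apply_apply, ContinuousLinearMap.map_tsum _ hx']
    refine tsum_congr fun i => ?_
    rw [innerSLFlip_apply_apply, ← innerSL_apply_apply ℂ, ContinuousLinearMap.map_tsum _ hy']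
    rfl
  rw [hprod, tsum_prod_eq_tsum_diag hF]
  · refine tsum_congr fun i => ?_
    simp only
    rw [e, hcc, one_mul]
  · intro k
    rw [← mul_zero ((starRingEnd ℂ) ζ ^ (k + 1)), ← h1 k, ← tsum_mul_left]
    refine tsum_congr fun i => ?_
    simp only
    rw [e, pow_add]
    linear_combination (starRingEnd ℂ) ζ ^ (k + 1) * ⟪x (i + (k + 1)), y i⟫_ℂ * hcc i
  · intro k
    rw [← mul_zero (ζ ^ (k + 1)), ← h2 k, ← tsum_mul_left]
    refine tsum_congr fun i => ?_
    simp only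
    rw [e, pow_add]
    linear_combination ζ ^ (k + 1) * ⟪x i, y (i + (k + 1))⟫_ℂ * hcc i

theorem summable_pow_mul {ζ : ℂ} (hζ : ‖ζ‖ = 1) {f : ℕ → ℂ} (hf : Summable fun ν => ‖f ν‖) :
    Summable fun ν => ‖ζ ^ ν * f ν‖ := by
  simpa [hζ] using hf

/-- The product of two Wiener-class series is the series of the Cauchy product. -/
theorem seriesM_mul {r s t : ℕ} {F : ℕ → Matrix (Fin r) (Fin s) ℂ}
    {K : ℕ → Matrix (Fin s) (Fin t) ℂ} (hF : ∀ a b, Summable fun ν => ‖F ν a b‖)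
    (hK : ∀ a b, Summable fun ν => ‖K ν a b‖) {ζ : ℂ} (hζ : ‖ζ‖ = 1) :
    seriesM F ζ * seriesM K ζ
      = seriesM (fun i => ∑ j ∈ Finset.range (i + 1), F (i - j) * K j) ζ := by
  ext a c
  have hs (b : Fin s) := summable_norm_sum_mul_range_of_summable_norm
    (summable_pow_mul hζ (hK b c)) (summable_pow_mul hζ (hF a b))
  have hb (b : Fin s) : (∑' ν, ζ ^ ν * F ν a b) * (∑' ν, ζ ^ ν * K ν b c)
      = ∑' n, ∑ k ∈ Finset.range (n + 1), ζ ^ k * K k b c * (ζ ^ (n - k) * F (n - k) a b) := by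
    rw [mul_comm]
    exact tsum_mul_tsum_eq_tsum_sum_range_of_summable_norm
      (summable_pow_mul hζ (hK b c)) (summable_pow_mul hζ (hF a b))
  simp only [Matrix.mul_apply, seriesM, Matrix.of_apply, hb]
  rw [← Summable.tsum_finsetSum fun b _ => (hs b).of_norm]
  refine tsum_congr fun n => ?_
  rw [Finset.sum_comm, Matrix.sum_apply, Finset.mul_sum]
  refine Finset.sum_congr rfl fun k hk => ?_
  rw [Matrix.mul_apply, Finset.mul_sum]
  refine Finset.sum_congr rfl fun b _ => ?_
  have : ζ ^ n = ζ ^ k * ζ ^ (n - k) := by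
    rw [← pow_add, Nat.add_sub_of_le (Nat.lt_succ_iff.mp (Finset.mem_range.mp hk))]
  rw [this]
  ring

/-- Two left inverses of a basis matrix `Θ` of `ker G₀` agree on `ker G₀`. -/
theorem mul_one_sub_eq_of_left_inverse {m p : ℕ} (hmp : m ≤ p) {G₀ : Matrix (Fin m) (Fin p) ℂ}
    {Ξ : Matrix (Fin p) (Fin m) ℂ} {Θ : Matrix (Fin p) (Fin (p - m)) ℂ} (hΞ : G₀ * Ξ = 1)
    (hΘ : G₀ * Θ = 0) {A B : Matrix (Fin (p - m)) (Fin p) ℂ} (hA : A * Θ = 1) (hB : B * Θ = 1) :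
    A * (1 - Ξ * G₀) = B * (1 - Ξ * G₀) := by
  have hsurj : Function.Surjective G₀.mulVecLin := fun v =>
    ⟨Ξ.mulVec v, by simp [Matrix.mulVec_mulVec, hΞ]⟩
  have hinj : Function.Injective Θ.mulVecLin := by
    refine Function.LeftInverse.injective (g := A.mulVecLin) fun v => ?_
    simp [Matrix.mulVec_mulVec, hA]
  have hle : LinearMap.range Θ.mulVecLin ≤ LinearMap.ker G₀.mulVecLin := by
    rintro _ ⟨v, rfl⟩
    simp [Matrix.mulVec_mulVec, hΘ]
  have hker : LinearMap.range Θ.mulVecLin = LinearMap.ker G₀.mulVecLin := by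
    refine Submodule.eq_of_le_of_finrank_le hle ?_
    have h := LinearMap.finrank_range_add_finrank_ker G₀.mulVecLin
    rw [LinearMap.range_eq_top.mpr hsurj, finrank_top] at h
    rw [LinearMap.finrank_range_of_inj hinj]
    simp at h ⊢
    omega
  have hM : G₀ * (1 - Ξ * G₀) = 0 := by
    rw [Matrix.mul_sub, Matrix.mul_one, ← Matrix.mul_assoc, hΞ, Matrix.one_mul, sub_self]
  refine Matrix.ext_of_mulVec_single fun i => ?_
  have hmem : (1 - Ξ * G₀).mulVec (Pi.single i 1) ∈ LinearMap.ker G₀.mulVecLin := by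
    simp only [LinearMap.mem_ker, Matrix.mulVecLin_apply, Matrix.mulVec_mulVec, hM,
      Matrix.zero_mulVec]
  rw [← hker] at hmem
  obtain ⟨k, hk⟩ := hmem
  rw [← Matrix.mulVec_mulVec, ← Matrix.mulVec_mulVec, ← hk]
  simp [Matrix.mulVec_mulVec, hA, hB]

open scoped ComplexOrder in
theorem isUnit_conjTranspose_mul_self {p q : ℕ} {Θ : Matrix (Fin p) (Fin q) ℂ}
    (h : ∀ w : Fin q → ℂ, Θ.mulVec w = 0 → w = 0) : IsUnit (Θᴴ * Θ) := by
  rw [← Matrix.mulVec_injective_iff_isUnit]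
  refine (injective_iff_map_eq_zero (Θᴴ * Θ).mulVecLin).mpr fun w hw => h w ?_
  exact (Matrix.conjTranspose_mul_self_mulVec_eq_zero Θ w).mp hw

/-- The `ℓ²` coefficient sequence of `z ↦ Y(z) v`. -/
def yVec {m p : ℕ} (TG HG : l2 p →L[ℂ] l2 m) (Tinv : l2 m →L[ℂ] l2 m) (v : ES p) : l2 p :=
  lp.single 2 0 v - shift (TG.adjoint (Tinv (HG (lp.single 2 0 v))))

/-- The orthogonal projection onto `ker T_G` applied to the embedding of `v`. -/
def projVec {m p : ℕ} (TG : l2 p →L[ℂ] l2 m) (Tinv : l2 m →L[ℂ] l2 m) (v : ES p) : l2 p :=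
  lp.single 2 0 v - TG.adjoint (Tinv (TG (lp.single 2 0 v)))

section ColumnSequences

variable {m p : ℕ} {G : ℕ → Matrix (Fin m) (Fin p) ℂ} {TG HG : l2 p →L[ℂ] l2 m}
  {Tinv : l2 m →L[ℂ] l2 m}

theorem yVec_zero (v : ES p) : yVec TG HG Tinv v 0 = v := by
  simp [yVec]

theorem yVec_succ (v : ES p) (i : ℕ) :
    yVec TG HG Tinv v (i + 1) = -(TG.adjoint (Tinv (HG (lp.single 2 0 v)))) i := by
  simp [yVec]

theorem yVec_coord {Yc : ℕ → Matrix (Fin p) (Fin p) ℂ} (hYc0 : Yc 0 = 1)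
    (hYc : ∀ (ν : ℕ) (a b : Fin p),
      Yc (ν + 1) a b = -(TG.adjoint (Tinv (HG (lp.single 2 0 (eVec p b))))) ν a)
    (v : ES p) (i : ℕ) (a : Fin p) : yVec TG HG Tinv v i a = ∑ b, Yc i a b * v b := by
  cases i with
  | zero => simp [yVec_zero, hYc0, Matrix.one_apply]
  | succ i =>
    have h := apply_single_coord ((TG.adjoint.comp Tinv).comp HG) 0 v i a
    simp only [ContinuousLinearMap.comp_apply] at h
    rw [yVec_succ, PiLp.neg_apply, h, ← Finset.sum_neg_distrib]
    exact Finset.sum_congr rfl fun b _ => by rw [hYc, neg_mul]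

theorem toeplitz_yVec
    (hT : ∀ x i a, (TG x) i a = ∑ j ∈ Finset.range (i + 1), ∑ b, G (i - j) a b * x j b)
    (hHG : ∀ (j : ℕ) (b : Fin p) (i : ℕ) (a : Fin m),
      (HG (lp.single 2 j (eVec p b))) i a = G (i + j + 1) a b)
    (hT2 : ∀ x, TG (TG.adjoint (Tinv x)) = x) (v : ES p) :
    TG (yVec TG HG Tinv v) = (lp.single 2 0 (WithLp.toLp 2 ((G 0).mulVec v)) : l2 m) := by
  ext i a
  rw [yVec, map_sub, toeplitz_shift hT, hT2, lp.coeFn_sub, Pi.sub_apply, PiLp.sub_apply, hT]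
  cases i with
  | zero => simp [Matrix.mulVec, dotProduct]
  | succ i =>
    rw [shift_succ, apply_single_coord, Finset.sum_range_succ']
    simp [hHG]

theorem inner_yVec_shift {h : l2 p} (hh : TG h = 0) (v : ES p) :
    ⟪yVec TG HG Tinv v, shift h⟫_ℂ = 0 := by
  rw [yVec, inner_sub_left, inner_shift_shift, ContinuousLinearMap.adjoint_inner_left, hh,
    lp.inner_single_left]
  simp

theorem toeplitz_projVec (hT2 : ∀ x, TG (TG.adjoint (Tinv x)) = x) (v : ES p) :
    TG (projVec TG Tinv v) = 0 := by
  rw [projVec, map_sub, hT2, sub_self]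

theorem inner_projVec {f : l2 p} (hf : TG f = 0) (v : ES p) :
    ⟪f, projVec TG Tinv v⟫_ℂ = ⟪f 0, v⟫_ℂ := by
  rw [projVec, inner_sub_right, ContinuousLinearMap.adjoint_inner_right, hf, inner_zero_left,
    sub_zero, lp.inner_single_right]

theorem projVec_zero_coord {q : ℕ} {Θ₀ : Matrix (Fin p) (Fin q) ℂ}
    (hΘ₀ : ∀ (a b : Fin p), (Θ₀ * Θ₀ᴴ) a b
      = (if a = b then 1 else 0) - (TG.adjoint (Tinv (TG (lp.single 2 0 (eVec p b))))) 0 a)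
    (v : ES p) : projVec TG Tinv v 0 = WithLp.toLp 2 ((Θ₀ * Θ₀ᴴ).mulVec v) := by
  ext a
  have h := apply_single_coord ((TG.adjoint.comp Tinv).comp TG) 0 v 0 a
  simp only [ContinuousLinearMap.comp_apply] at h
  rw [projVec, lp.coeFn_sub, Pi.sub_apply, PiLp.sub_apply, h]
  simp [Matrix.mulVec, dotProduct, hΘ₀, sub_mul, Finset.sum_sub_distrib]

open scoped ComplexOrder in
/-- `G₀ Θ₀ = 0`. -/
theorem mul_eq_zero_of_projVec {q : ℕ} {Θ₀ : Matrix (Fin p) (Fin q) ℂ}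
    (hT : ∀ x i a, (TG x) i a = ∑ j ∈ Finset.range (i + 1), ∑ b, G (i - j) a b * x j b)
    (hT2 : ∀ x, TG (TG.adjoint (Tinv x)) = x)
    (hΘ₀ : ∀ (a b : Fin p), (Θ₀ * Θ₀ᴴ) a b
      = (if a = b then 1 else 0) - (TG.adjoint (Tinv (TG (lp.single 2 0 (eVec p b))))) 0 a) :
    G 0 * Θ₀ = 0 := by
  have h : G 0 * (Θ₀ * Θ₀ᴴ) = 0 := by
    refine Matrix.ext_of_mulVec_single fun b => ?_
    have hz := toeplitz_zero hT (projVec TG Tinv (eVec p b))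
    rw [toeplitz_projVec hT2, projVec_zero_coord hΘ₀, Matrix.mulVec_mulVec] at hz
    rw [Matrix.zero_mulVec]
    exact (congrArg WithLp.ofLp hz).symm
  rw [← Matrix.self_mul_conjTranspose_eq_zero, Matrix.conjTranspose_mul, Matrix.mul_assoc,
    ← Matrix.mul_assoc Θ₀, ← Matrix.mul_assoc, h, Matrix.zero_mul]

/-- Column `b` of a matrix as a Euclidean vector. -/
abbrev colVec {r s : ℕ} (A : Matrix (Fin r) (Fin s) ℂ) (b : Fin s) : ES r :=
  WithLp.toLp 2 fun a => A a b

theorem inner_colVec {r s t : ℕ} (A : Matrix (Fin r) (Fin s) ℂ) (B : Matrix (Fin r) (Fin t) ℂ)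
    (a : Fin s) (b : Fin t) : ⟪colVec A a, colVec B b⟫_ℂ = (Aᴴ * B) a b := by
  simp [PiLp.inner_apply, Matrix.mul_apply, mul_comm]

/-- `θ = Y Θ₀` is isometric on the unit circle. -/
theorem conjTranspose_mul_self_eq_one {q : ℕ} {Θ₀ : Matrix (Fin p) (Fin q) ℂ}
    (hT : ∀ x i a, (TG x) i a = ∑ j ∈ Finset.range (i + 1), ∑ b, G (i - j) a b * x j b)
    (hHG : ∀ (j : ℕ) (b : Fin p) (i : ℕ) (a : Fin m),
      (HG (lp.single 2 j (eVec p b))) i a = G (i + j + 1) a b)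
    (hT2 : ∀ x, TG (TG.adjoint (Tinv x)) = x)
    (hΘ₀ker : ∀ w : Fin q → ℂ, Θ₀.mulVec w = 0 → w = 0)
    (hΘ₀ : ∀ (a b : Fin p), (Θ₀ * Θ₀ᴴ) a b
      = (if a = b then 1 else 0) - (TG.adjoint (Tinv (TG (lp.single 2 0 (eVec p b))))) 0 a)
    {Yc : ℕ → Matrix (Fin p) (Fin p) ℂ} (hYc0 : Yc 0 = 1)
    (hYc : ∀ (ν : ℕ) (a b : Fin p),
      Yc (ν + 1) a b = -(TG.adjoint (Tinv (HG (lp.single 2 0 (eVec p b))))) ν a)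
    (hYcW : ∀ a b, Summable fun ν => ‖Yc ν a b‖) {ζ : ℂ} (hζ : ‖ζ‖ = 1) :
    (seriesM Yc ζ * Θ₀)ᴴ * (seriesM Yc ζ * Θ₀) = 1 := by
  have hunit := isUnit_conjTranspose_mul_self hΘ₀ker
  rw [Matrix.isUnit_iff_isUnit_det] at hunit
  set f : Fin q → l2 p := fun a => yVec TG HG Tinv (colVec Θ₀ a) with hf
  have hG := mul_eq_zero_of_projVec hT hT2 hΘ₀
  have hfker (a : Fin q) : TG (f a) = 0 := by
    have h0 : (G 0).mulVec (colVec Θ₀ a) = 0 := funext fun i => congrFun (congrFun hG i) a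
    rw [hf, toeplitz_yVec hT hHG hT2, h0]
    exact lp.single_zero _ _
  have hdiag (a b : Fin q) : ⟪f a, f b⟫_ℂ = (1 : Matrix (Fin q) (Fin q) ℂ) a b := by
    have e : f b 0 = projVec TG Tinv (colVec (Θ₀ * (Θ₀ᴴ * Θ₀)⁻¹) b) 0 := by
      have h : Θ₀ * Θ₀ᴴ * (Θ₀ * (Θ₀ᴴ * Θ₀)⁻¹) = Θ₀ := by
        rw [Matrix.mul_assoc, ← Matrix.mul_assoc Θ₀ᴴ, Matrix.mul_nonsing_inv _ hunit,
          Matrix.mul_one]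
      rw [projVec_zero_coord hΘ₀, hf, yVec_zero]
      exact congrArg (WithLp.toLp 2) (funext fun i => (congrFun (congrFun h i) b).symm)
    rw [inner_eq_of_coord_zero_eq hT (fun h hh => inner_yVec_shift hh _) (hfker b)
      (toeplitz_projVec hT2 _) e, inner_projVec (hfker a), hf, yVec_zero, inner_colVec,
      ← Matrix.mul_assoc, Matrix.mul_nonsing_inv _ hunit]
  have hoff (a b : Fin q) (k : ℕ) : ∑' i, ⟪f a (i + (k + 1)), f b i⟫_ℂ = 0 := by
    rw [← inner_iterate_shift, Function.iterate_succ_apply']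
    exact inner_yVec_shift (toeplitz_iterate_shift hT (hfker b) k) _
  have hoff' (a b : Fin q) (k : ℕ) : ∑' i, ⟪f a i, f b (i + (k + 1))⟫_ℂ = 0 := by
    have h := congrArg (starRingEnd ℂ) (hoff b a k)
    rw [Complex.conj_tsum, map_zero] at h
    simpa only [inner_conj_symm] using h
  have hcoord (a : Fin q) (i : ℕ) (c : Fin p) : f a i c = ∑ b, Yc i c b * Θ₀ b a :=
    yVec_coord hYc0 hYc _ i c
  have hsum (a : Fin q) : Summable fun i => ‖f a i‖ := by
    have hc (c : Fin p) : Summable fun i => ‖f a i c‖ := by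
      refine .of_nonneg_of_le (fun _ => norm_nonneg _) (fun i => ?_)
        (summable_sum fun b (_ : b ∈ Finset.univ) => (hYcW c b).mul_right ‖Θ₀ b a‖)
      rw [hcoord]
      exact (norm_sum_le _ _).trans_eq (Finset.sum_congr rfl fun b _ => norm_mul _ _)
    refine .of_nonneg_of_le (fun _ => norm_nonneg _) (fun i => ?_)
      (summable_sum fun c (_ : c ∈ Finset.univ) => hc c)
    have h := congrArg norm (ES.eq_sum_smul_eVec (f a i))
    rw [h]
    exact (norm_sum_le _ _).trans_eq (Finset.sum_congr rfl fun b _ => by simp [norm_smul])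
  have hcol (a : Fin q) : colVec (seriesM Yc ζ * Θ₀) a = ∑' i, ζ ^ i • f a i := by
    have hs : Summable fun i => ζ ^ i • f a i :=
      .of_norm (by simpa [norm_smul, hζ] using hsum a)
    ext c
    have h : (∑' i, ζ ^ i • f a i : ES p) c = ∑' i, ζ ^ i * f a i c :=
      (EuclideanSpace.proj (𝕜 := ℂ) c).map_tsum hs
    rw [h]
    simp only [hcoord]
    simp only [Matrix.mul_apply, seriesM, Matrix.of_apply, ← tsum_mul_right]
    rw [← Summable.tsum_finsetSum fun b _ =>
      ((summable_pow_mul hζ (hYcW c b)).of_norm.mul_right _)]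
    exact tsum_congr fun i => by rw [Finset.mul_sum]; simp only [mul_assoc]
  ext a b
  rw [← inner_colVec, hcol, hcol,
    inner_tsum_smul (hsum a) (hsum b) hζ (hoff a b) (hoff' a b), ← hdiag, lp.inner_eq_tsum]

/-- `G(ζ) Y(ζ) = G₀` on the unit circle. -/
theorem seriesM_mul_seriesM_eq
    (hGW : ∀ (a : Fin m) (b : Fin p), Summable fun ν => ‖G ν a b‖)
    (hT : ∀ x i a, (TG x) i a = ∑ j ∈ Finset.range (i + 1), ∑ b, G (i - j) a b * x j b)
    (hHG : ∀ (j : ℕ) (b : Fin p) (i : ℕ) (a : Fin m),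
      (HG (lp.single 2 j (eVec p b))) i a = G (i + j + 1) a b)
    (hT2 : ∀ x, TG (TG.adjoint (Tinv x)) = x)
    {Yc : ℕ → Matrix (Fin p) (Fin p) ℂ} (hYc0 : Yc 0 = 1)
    (hYc : ∀ (ν : ℕ) (a b : Fin p),
      Yc (ν + 1) a b = -(TG.adjoint (Tinv (HG (lp.single 2 0 (eVec p b))))) ν a)
    (hYcW : ∀ a b, Summable fun ν => ‖Yc ν a b‖) {ζ : ℂ} (hζ : ‖ζ‖ = 1) :
    seriesM G ζ * seriesM Yc ζ = G 0 := by
  rw [seriesM_mul hGW hYcW hζ]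
  ext a b
  have hc (i : ℕ) : (∑ j ∈ Finset.range (i + 1), G (i - j) * Yc j) a b
      = (lp.single 2 0 (WithLp.toLp 2 ((G 0).mulVec (eVec p b))) : l2 m) i a := by
    rw [← toeplitz_yVec hT hHG hT2, hT, Matrix.sum_apply]
    refine Finset.sum_congr rfl fun j _ => ?_
    rw [Matrix.mul_apply]
    refine Finset.sum_congr rfl fun c _ => ?_
    rw [yVec_coord hYc0 hYc]
    simp
  simp only [seriesM, Matrix.of_apply, hc]
  rw [tsum_eq_single 0 fun i hi => by simp [hi]]
  simp

end ColumnSequences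

/-- For `G ∈ W₊^{m×p}` with `T_G T_G*` strictly positive, the function
`H(ζ) = (Θ₀*Θ₀)⁻¹ Θ₀* (I_p − Ξ₀G₀) Y(ζ)⁻¹` coincides on the unit circle with the
Tolokonnikov-type function `ζ ↦ θ(ζ)*(I_p − Ξ(ζ)G(ζ))`, where `Ξ(z) = Y(z)Ξ₀` and
`θ(z) = Y(z)Θ₀`. -/
theorem bezout_corona_stmt15
    (m p : ℕ) (hm : 0 < m) (hmp : m ≤ p)
    (G : ℕ → Matrix (Fin m) (Fin p) ℂ)
    (hGW : ∀ (a : Fin m) (b : Fin p), Summable fun ν => ‖G ν a b‖)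
    (TG : l2 p →L[ℂ] l2 m)
    (hTG : ∀ (j : ℕ) (b : Fin p) (i : ℕ) (a : Fin m),
      (TG (lp.single 2 j (eVec p b))) i a = if j ≤ i then G (i - j) a b else 0)
    (HG : l2 p →L[ℂ] l2 m)
    (hHG : ∀ (j : ℕ) (b : Fin p) (i : ℕ) (a : Fin m),
      (HG (lp.single 2 j (eVec p b))) i a = G (i + j + 1) a b)
    (Tinv : l2 m →L[ℂ] l2 m)
    (hT1 : ∀ x, Tinv (TG (TG.adjoint x)) = x)
    (hT2 : ∀ x, TG (TG.adjoint (Tinv x)) = x)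
    (Ξ₀ : Matrix (Fin p) (Fin m) ℂ)
    (hΞ₀ : ∀ (a : Fin p) (b : Fin m),
      Ξ₀ a b = (TG.adjoint (Tinv (lp.single 2 0 (eVec m b)))) 0 a)
    (Θ₀ : Matrix (Fin p) (Fin (p - m)) ℂ)
    (hΘ₀ker : ∀ w : Fin (p - m) → ℂ, Θ₀.mulVec w = 0 → w = 0)
    (hΘ₀ : ∀ (a b : Fin p), (Θ₀ * Θ₀ᴴ) a b
      = (if a = b then 1 else 0) - (TG.adjoint (Tinv (TG (lp.single 2 0 (eVec p b))))) 0 a)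
    (Yc : ℕ → Matrix (Fin p) (Fin p) ℂ)
    (hYc0 : Yc 0 = 1)
    (hYc : ∀ (ν : ℕ) (a b : Fin p),
      Yc (ν + 1) a b = -(TG.adjoint (Tinv (HG (lp.single 2 0 (eVec p b))))) ν a)
    (hYcW : ∀ a b, Summable fun ν => ‖Yc ν a b‖)
    (hYunit : ∀ ζ : ℂ, ‖ζ‖ = 1 → IsUnit (seriesM Yc ζ))
    (H0 : Matrix (Fin (p - m)) (Fin p) ℂ)
    (hH0 : H0 = (Θ₀ᴴ * Θ₀)⁻¹ * Θ₀ᴴ * (1 - Ξ₀ * G 0)) :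
    ∀ ζ : ℂ, ‖ζ‖ = 1 →
      H0 * (seriesM Yc ζ)⁻¹
        = (seriesM Yc ζ * Θ₀)ᴴ * (1 - (seriesM Yc ζ * Ξ₀) * seriesM G ζ) := by
  intro ζ hζ
  have hT := toeplitz_apply hTG
  have hΞ : G 0 * Ξ₀ = 1 := by
    ext a b
    have h := toeplitz_zero hT (TG.adjoint (Tinv (lp.single 2 0 (eVec m b))))
    rw [hT2] at h
    have h' := congrArg (fun v : ES m => v a) h
    simp only [Matrix.mulVec, dotProduct, ← hΞ₀] at h'
    rw [Matrix.mul_apply, ← h']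
    simp [Matrix.one_apply]
  have hGΘ := mul_eq_zero_of_projVec hT hT2 hΘ₀
  have hunit := isUnit_conjTranspose_mul_self hΘ₀ker
  rw [Matrix.isUnit_iff_isUnit_det] at hunit
  have hinner := conjTranspose_mul_self_eq_one hT hHG hT2 hΘ₀ker hΘ₀ hYc0 hYc hYcW hζ
  have hGY := seriesM_mul_seriesM_eq hGW hT hHG hT2 hYc0 hYc hYcW hζ
  have hYu := hYunit ζ hζ
  rw [Matrix.isUnit_iff_isUnit_det] at hYu
  set Y := seriesM Yc ζ
  have key := mul_one_sub_eq_of_left_inverse hmp hΞ hGΘ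
    (A := (Θ₀ᴴ * Θ₀)⁻¹ * Θ₀ᴴ) (B := (Y * Θ₀)ᴴ * Y)
    (by rw [Matrix.mul_assoc, Matrix.nonsing_inv_mul _ hunit])
    (by rw [Matrix.mul_assoc, hinner])
  have hR : (1 - Y * Ξ₀ * seriesM G ζ) * Y = Y * (1 - Ξ₀ * G 0) := by
    rw [Matrix.sub_mul, Matrix.mul_assoc, hGY, Matrix.one_mul, Matrix.mul_sub, Matrix.mul_one,
      Matrix.mul_assoc]
  rw [hH0, key, Matrix.mul_assoc ((Y * Θ₀)ᴴ) Y, ← hR, Matrix.mul_assoc, Matrix.mul_assoc,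
    Matrix.mul_nonsing_inv _ hYu, Matrix.mul_one]
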